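/- arXiv:2210.17536 — 6 statements merged into one kernel-verified Lean document; each statement's English description precedes it below -/
import Mathlib

section
/- Let a, u, t be real numbers with 0 ≤ a ≤ u ≤ t and a < t. Then for every real λ > 0: e^{−2(t−u)λ} − e^{−2(t−a)λ} ≤ (u−a)/(t−a); in particular the supremum over λ ∈ (0,∞) of e^{−2(t−u)λ} − e^{−2(t−a)λ} = e^{−2(t−u)λ}(1 − e^{−2(u−a)λ}) is at most (u−a)/(t−a). -/
/-- Convexity bound: `e^{(1-r)x} - e^x ≤ r` for `r ∈ [0,1]` and every real `x`. -/
theorem Real.exp_one_sub_mul_sub_exp_le {r : ℝ} (hr₀ : 0 ≤ r) (hr₁ : r ≤ 1) (x : ℝ) :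
    Real.exp ((1 - r) * x) - Real.exp x ≤ r := by
  have h := convexOn_exp.2 (Set.mem_univ x) (Set.mem_univ 0) (sub_nonneg.2 hr₁) hr₀ (by ring)
  simp only [smul_eq_mul, mul_zero, add_zero, Real.exp_zero, mul_one] at h
  nlinarith [mul_nonneg hr₀ (Real.exp_pos x).le]

/-- For `0 ≤ a ≤ u ≤ t` with `a < t` and every `λ > 0`:
`e^{-2(t-u)λ} - e^{-2(t-a)λ} ≤ (u-a)/(t-a)`; in particular the supremum over
`λ ∈ (0,∞)` of this quantity is at most `(u-a)/(t-a)`. -/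
theorem exp_diff_le_ratio (a u t : ℝ) (ha : 0 ≤ a) (hau : a ≤ u) (hut : u ≤ t) (hat : a < t) :
    (∀ l : ℝ, 0 < l →
        Real.exp (-2 * (t - u) * l) - Real.exp (-2 * (t - a) * l) ≤ (u - a) / (t - a)) ∧
      sSup {y : ℝ | ∃ l ∈ Set.Ioi (0 : ℝ),
          y = Real.exp (-2 * (t - u) * l) - Real.exp (-2 * (t - a) * l)}
        ≤ (u - a) / (t - a) := by
  have hta : 0 < t - a := sub_pos.2 hat
  have hr₀ : 0 ≤ (u - a) / (t - a) := div_nonneg (sub_nonneg.2 hau) hta.le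
  have hr₁ : (u - a) / (t - a) ≤ 1 := (div_le_one hta).2 (by linarith)
  have key (l : ℝ) :
      Real.exp (-2 * (t - u) * l) - Real.exp (-2 * (t - a) * l) ≤ (u - a) / (t - a) := by
    convert Real.exp_one_sub_mul_sub_exp_le hr₀ hr₁ (-2 * (t - a) * l) using 3
    field_simp
    ring
  refine ⟨fun l _ => key l, Real.sSup_le ?_ hr₀⟩
  rintro _ ⟨l, _, rfl⟩
  exact key l
end

section
/- Let U be a real Hilbert space and let B : U →L[ℝ] H be a continuous linear map whose Hilbert-space adjoint B† satisfies ∑'_i ‖B† e_i‖²_U < ∞. Then for every t ≥ 0: ∫_0^t ∑'_i (−λ_i) e^{2(t−u)λ_i} ‖B† e_i‖²_U du = (1/2) ∑'_i (1 − e^{2tλ_i}) ‖B† e_i‖²_U ≤ (1/2) ∑'_i ‖B† e_i‖²_U. -/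
open scoped ENNReal
open MeasureTheory

/-- The function `u ↦ -l * exp (2 * (t - u) * l) * c` integrates over `(0, t]` to half of
`(1 - exp (2 * t * l)) * c`. -/
theorem lintegral_Ioc_neg_mul_exp_mul {l c t : ℝ} (hl : l ≤ 0) (hc : 0 ≤ c) (ht : 0 ≤ t) :
    ∫⁻ u in Set.Ioc (0 : ℝ) t, ENNReal.ofReal (-l * Real.exp (2 * (t - u) * l) * c) =
      (1 / 2 : ℝ≥0∞) * ENNReal.ofReal ((1 - Real.exp (2 * t * l)) * c) := by
  have hcont : Continuous fun u : ℝ => -l * Real.exp (2 * (t - u) * l) * c := by fun_prop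
  have hderiv (u : ℝ) : HasDerivAt (fun u : ℝ => 1 / 2 * Real.exp (2 * (t - u) * l) * c)
      (-l * Real.exp (2 * (t - u) * l) * c) u := by
    have h := (((((hasDerivAt_id u).const_sub t).const_mul 2).mul_const l).exp.const_mul
      (1 / 2)).mul_const c
    refine h.congr_deriv ?_
    simp only [id_eq]
    ring
  rw [← ofReal_integral_eq_lintegral_ofReal hcont.integrableOn_Ioc
      (ae_of_all _ fun u => mul_nonneg (mul_nonneg (neg_nonneg.2 hl) (Real.exp_pos _).le) hc),
    ← intervalIntegral.integral_of_le ht,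
    intervalIntegral.integral_eq_sub_of_hasDerivAt (fun u _ => hderiv u)
      (hcont.intervalIntegrable 0 t)]
  have hhalf : (1 / 2 : ℝ≥0∞) = ENNReal.ofReal (1 / 2) := by
    rw [ENNReal.ofReal_div_of_pos two_pos]
    simp
  rw [hhalf, ← ENNReal.ofReal_mul (by norm_num)]
  congr 1
  simp only [sub_self, sub_zero, mul_zero, zero_mul, Real.exp_zero]
  ring

/-- For a Hilbert–Schmidt operator `B`:
`∫_0^t ∑'_i (-λ_i) e^{2(t-u)λ_i} ‖B† e_i‖² du = (1/2) ∑'_i (1 - e^{2tλ_i}) ‖B† e_i‖²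
  ≤ (1/2) ∑'_i ‖B† e_i‖²`, all series taken in `[0,∞]`. -/
theorem integral_semigroup_hs_bound
    {H : Type*} [NormedAddCommGroup H] [InnerProductSpace ℝ H] [CompleteSpace H]
    {U : Type*} [NormedAddCommGroup U] [InnerProductSpace ℝ U] [CompleteSpace U]
    {ι : Type*} [Countable ι] (e : HilbertBasis ι ℝ H) (lam : ι → ℝ)
    (m M : ℝ) (hm : 0 < m) (hbound : ∀ i, m ≤ -lam i ∧ -lam i ≤ M)
    (B : U →L[ℝ] H)
    (hHS : (∑' i, ENNReal.ofReal (‖ContinuousLinearMap.adjoint B (e i)‖ ^ 2)) < ⊤)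
    (t : ℝ) (ht : 0 ≤ t) :
    (∫⁻ u in Set.Ioc (0 : ℝ) t,
        ∑' i, ENNReal.ofReal
          ((-lam i) * Real.exp (2 * (t - u) * lam i) *
            ‖ContinuousLinearMap.adjoint B (e i)‖ ^ 2))
      = (1 / 2 : ℝ≥0∞) *
          ∑' i, ENNReal.ofReal
            ((1 - Real.exp (2 * t * lam i)) * ‖ContinuousLinearMap.adjoint B (e i)‖ ^ 2) ∧
    (1 / 2 : ℝ≥0∞) *
        (∑' i, ENNReal.ofReal
          ((1 - Real.exp (2 * t * lam i)) * ‖ContinuousLinearMap.adjoint B (e i)‖ ^ 2))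
      ≤ (1 / 2 : ℝ≥0∞) *
          ∑' i, ENNReal.ofReal (‖ContinuousLinearMap.adjoint B (e i)‖ ^ 2) := by
  have hlam (i : ι) : lam i ≤ 0 := by linarith [(hbound i).1]
  constructor
  · rw [lintegral_tsum fun i => by fun_prop, ← ENNReal.tsum_mul_left]
    exact tsum_congr fun i => lintegral_Ioc_neg_mul_exp_mul (hlam i) (sq_nonneg _) ht
  · gcongr with i
    exact mul_le_of_le_one_left (sq_nonneg _) (sub_le_self _ (Real.exp_pos _).le)
end

section
/- Let U be a real Hilbert space, let s > 0, and let Q : [0,s] → (U →L[ℝ] H) be a map such that u ↦ ‖(Q u)† e_i‖_U is measurable on [0,s] for each i, such that sup_{u∈[0,s]} ‖Q u‖²_HS < ∞, and such that ∫_0^s ‖Q u − Q s‖²_HS/(s−u) du < ∞. Then ( ∫_0^s ∑'_i (−λ_i) e^{2λ_i (s−u)} ‖(Q u)† e_i‖²_U du )^{1/2} ≤ ( ∫_0^s ‖Q u − Q s‖²_HS / (2e(s−u)) du )^{1/2} + ‖Q s‖_HS / √2. -/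
open scoped ENNReal
open MeasureTheory

/-- The squared Hilbert–Schmidt norm `‖z‖²_HS = ∑'_i ‖z† e_i‖²` of a continuous linear map
`z : U →L[ℝ] H`, computed along a Hilbert basis `e` of `H`, with values in `[0,∞]`. -/
noncomputable def hsNormSq {H U : Type*}
    [NormedAddCommGroup H] [InnerProductSpace ℝ H] [CompleteSpace H]
    [NormedAddCommGroup U] [InnerProductSpace ℝ U] [CompleteSpace U]
    {ι : Type*} (e : HilbertBasis ι ℝ H) (z : U →L[ℝ] H) : ℝ≥0∞ :=
  ∑' i, ENNReal.ofReal (‖ContinuousLinearMap.adjoint z (e i)‖ ^ 2)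

/-- Minkowski's inequality for the mixed `L²(ℓ²)` norm. -/
theorem lintegral_tsum_add_rpow_two_le {α ι : Type*} [MeasurableSpace α] [Countable ι]
    {μ : Measure α} {p q : ι → α → ℝ≥0∞}
    (hp : ∀ i, AEMeasurable (p i) μ) (hq : ∀ i, AEMeasurable (q i) μ) :
    (∫⁻ a, ∑' i, (p i a + q i a) ^ (2 : ℝ) ∂μ) ^ (1 / 2 : ℝ)
      ≤ (∫⁻ a, ∑' i, p i a ^ (2 : ℝ) ∂μ) ^ (1 / 2 : ℝ)
        + (∫⁻ a, ∑' i, q i a ^ (2 : ℝ) ∂μ) ^ (1 / 2 : ℝ) := by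
  have hroot : ∀ x : ℝ≥0∞, (x ^ (1 / 2 : ℝ)) ^ (2 : ℝ) = x := fun x => by
    rw [← ENNReal.rpow_mul]; norm_num
  have hpt : ∀ a, (∑' i, (p i a + q i a) ^ (2 : ℝ)) ^ (1 / 2 : ℝ)
      ≤ (∑' i, p i a ^ (2 : ℝ)) ^ (1 / 2 : ℝ) + (∑' i, q i a ^ (2 : ℝ)) ^ (1 / 2 : ℝ) := by
    intro a
    let _ : MeasurableSpace ι := ⊤
    have h := ENNReal.lintegral_Lp_add_le (μ := (Measure.count : Measure ι)) (p := 2)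
      (f := fun i => p i a) (g := fun i => q i a)
      (measurable_from_top.aemeasurable) (measurable_from_top.aemeasurable) (by norm_num)
    simpa only [lintegral_count, Pi.add_apply] using h
  have hpm : AEMeasurable (fun a => (∑' i, p i a ^ (2 : ℝ)) ^ (1 / 2 : ℝ)) μ :=
    (AEMeasurable.tsum fun i => (hp i).pow_const _).pow_const _
  have hqm : AEMeasurable (fun a => (∑' i, q i a ^ (2 : ℝ)) ^ (1 / 2 : ℝ)) μ :=
    (AEMeasurable.tsum fun i => (hq i).pow_const _).pow_const _
  have h := ENNReal.lintegral_Lp_add_le (p := 2) hpm hqm (by norm_num)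
  simp only [Pi.add_apply, hroot] at h
  refine le_trans ?_ h
  gcongr with a
  calc _ = ((∑' i, (p i a + q i a) ^ (2 : ℝ)) ^ (1 / 2 : ℝ)) ^ (2 : ℝ) := (hroot _).symm
    _ ≤ _ := ENNReal.rpow_le_rpow (hpt a) (by norm_num)

theorem mul_exp_neg_two_mul_le (a : ℝ) {t : ℝ} (ht : 0 < t) :
    a * Real.exp (-(2 * a * t)) ≤ 1 / (2 * Real.exp 1 * t) := by
  have h := Real.add_one_le_exp (2 * a * t - 1)
  rw [Real.exp_sub, le_div_iff₀ (Real.exp_pos _)] at h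
  rw [Real.exp_neg, ← div_eq_mul_inv, div_le_div_iff₀ (Real.exp_pos _) (by positivity)]
  linarith

theorem lintegral_mul_exp_two_mul_le_half {l s : ℝ} (hl : l < 0) (hs : 0 ≤ s) :
    ∫⁻ u in Set.Ioc (0 : ℝ) s, ENNReal.ofReal (-l * Real.exp (2 * l * (s - u))) ≤ 2⁻¹ := by
  have hcont : Continuous fun u : ℝ => -l * Real.exp (2 * l * (s - u)) := by fun_prop
  have hint : ∫ u in (0 : ℝ)..s, -l * Real.exp (2 * l * (s - u))
      = 1 / 2 - Real.exp (2 * l * s) / 2 := by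
    rw [intervalIntegral.integral_eq_sub_of_hasDerivAt
      (f := fun u => Real.exp (2 * l * (s - u)) / 2) _ (hcont.intervalIntegrable _ _)]
    · simp
    · intro u _
      have h := ((((hasDerivAt_id' u).const_sub s).const_mul (2 * l)).exp).div_const 2
      exact h.congr_deriv (by ring)
  rw [← ofReal_integral_eq_lintegral_ofReal (hcont.integrableOn_Ioc)
    (Filter.Eventually.of_forall fun u => mul_nonneg (by linarith) (Real.exp_pos _).le),
    ← intervalIntegral.integral_of_le hs, hint]
  refine (ENNReal.ofReal_le_ofReal (q := 2⁻¹) ?_).trans_eq ?_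
  · linarith [Real.exp_pos (2 * l * s)]
  · rw [ENNReal.ofReal_inv_of_pos two_pos]; simp

/-- `(∫_0^s ∑'_i (-λ_i) e^{2λ_i(s-u)} ‖(Q u)† e_i‖² du)^{1/2}
  ≤ (∫_0^s ‖Q u - Q s‖²_HS/(2e(s-u)) du)^{1/2} + ‖Q s‖_HS/√2`. -/
theorem sqrt_integral_semigroup_hs_bound
    {H : Type*} [NormedAddCommGroup H] [InnerProductSpace ℝ H] [CompleteSpace H]
    {U : Type*} [NormedAddCommGroup U] [InnerProductSpace ℝ U] [CompleteSpace U]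
    {ι : Type*} [Countable ι] (e : HilbertBasis ι ℝ H) (lam : ι → ℝ)
    (m M : ℝ) (hm : 0 < m) (hbound : ∀ i, m ≤ -lam i ∧ -lam i ≤ M)
    (s : ℝ) (hs : 0 < s) (Q : ℝ → (U →L[ℝ] H))
    (hmeas : ∀ i, Measurable fun u : Set.Icc (0 : ℝ) s =>
      ‖ContinuousLinearMap.adjoint (Q u) (e i)‖)
    (hsup : (⨆ u ∈ Set.Icc (0 : ℝ) s, hsNormSq e (Q u)) < ⊤)
    (hint : (∫⁻ u in Set.Ioc (0 : ℝ) s,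
        hsNormSq e (Q u - Q s) / ENNReal.ofReal (s - u)) < ⊤) :
    (∫⁻ u in Set.Ioc (0 : ℝ) s,
        ∑' i, ENNReal.ofReal
          ((-lam i) * Real.exp (2 * lam i * (s - u)) *
            ‖ContinuousLinearMap.adjoint (Q u) (e i)‖ ^ 2)) ^ (1 / 2 : ℝ)
      ≤ (∫⁻ u in Set.Ioc (0 : ℝ) s,
            hsNormSq e (Q u - Q s) / ENNReal.ofReal (2 * Real.exp 1 * (s - u))) ^ (1 / 2 : ℝ)
        + (hsNormSq e (Q s)) ^ (1 / 2 : ℝ) / ENNReal.ofReal (Real.sqrt 2) := by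
  set f : ι → ℝ → ℝ := fun i u => ‖ContinuousLinearMap.adjoint (Q u) (e i)‖
  set w : ι → ℝ → ℝ := fun i u => -lam i * Real.exp (2 * lam i * (s - u))
  have hlam : ∀ i, lam i < 0 := fun i => by linarith [(hbound i).1]
  have hw0 : ∀ i u, 0 ≤ w i u := fun i u =>
    mul_nonneg (by linarith [hlam i]) (Real.exp_pos _).le
  have hfm : ∀ i, AEMeasurable (f i) (volume.restrict (Set.Ioc 0 s)) := fun i =>
    (aemeasurable_restrict_of_measurable_subtype measurableSet_Icc (hmeas i)).mono_measure
      (Measure.restrict_mono Set.Ioc_subset_Icc_self le_rfl)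
  have hwm : ∀ i, Measurable (w i) := fun i => by
    have : Continuous (w i) := by fun_prop
    exact this.measurable
  have hsq : ∀ i u x, ENNReal.ofReal (√(w i u) * |x|) ^ (2 : ℝ)
      = ENNReal.ofReal (w i u * x ^ 2) := fun i u x => by
    rw [ENNReal.rpow_two, ← ENNReal.ofReal_pow (by positivity), mul_pow, sq_abs,
      Real.sq_sqrt (hw0 i u)]
  have hmink := lintegral_tsum_add_rpow_two_le (μ := volume.restrict (Set.Ioc 0 s))
    (p := fun i u => ENNReal.ofReal (√(w i u) * |f i u - f i s|))
    (q := fun i u => ENNReal.ofReal (√(w i u) * |f i s|))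
    (fun i => ((hwm i).sqrt.aemeasurable.mul
      ((hfm i).sub_const (f i s)).abs).ennreal_ofReal)
    (fun i => ((hwm i).sqrt.aemeasurable.mul_const _).ennreal_ofReal)
  simp only [hsq] at hmink
  refine le_trans ?_ (hmink.trans (add_le_add ?_ ?_))
  · gcongr with u i
    rw [← hsq, ← ENNReal.ofReal_add (by positivity) (by positivity), ← mul_add]
    gcongr
    calc |f i u| = |(f i u - f i s) + f i s| := by rw [sub_add_cancel]
      _ ≤ _ := abs_add_le _ _
  · refine ENNReal.rpow_le_rpow (lintegral_mono_ae ?_) (by norm_num)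
    filter_upwards [ae_restrict_mem measurableSet_Ioc,
      ae_restrict_of_ae (Measure.ae_ne volume s)] with u hu hus
    have ht : 0 < s - u := sub_pos.2 (lt_of_le_of_ne hu.2 hus)
    rw [hsNormSq, div_eq_mul_inv, ← ENNReal.tsum_mul_right]
    refine ENNReal.tsum_le_tsum fun i => ?_
    rw [← div_eq_mul_inv, ← ENNReal.ofReal_div_of_pos (by positivity), div_eq_mul_one_div,
      mul_comm (_ ^ 2)]
    refine ENNReal.ofReal_le_ofReal (mul_le_mul ?_ ?_ (sq_nonneg _) (by positivity))
    · have h := mul_exp_neg_two_mul_le (-lam i) ht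
      rwa [show -(2 * -lam i * (s - u)) = 2 * lam i * (s - u) by ring] at h
    · rw [← sq_abs]
      gcongr
      rw [map_sub, sub_apply]
      exact abs_norm_sub_norm_le _ _
  · have hhalf : ∫⁻ u in Set.Ioc 0 s, ∑' i, ENNReal.ofReal (w i u * f i s ^ 2)
        ≤ hsNormSq e (Q s) / 2 := by
      rw [lintegral_tsum fun i => ((hwm i).mul_const _).ennreal_ofReal.aemeasurable,
        hsNormSq, div_eq_mul_inv, ← ENNReal.tsum_mul_right]
      refine ENNReal.tsum_le_tsum fun i => ?_
      simp_rw [ENNReal.ofReal_mul (hw0 i _)]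
      rw [lintegral_mul_const _ (hwm i).ennreal_ofReal, mul_comm]
      gcongr
      exact lintegral_mul_exp_two_mul_le_half (hlam i) hs.le
    refine (ENNReal.rpow_le_rpow hhalf (by norm_num)).trans_eq ?_
    rw [ENNReal.div_rpow_of_nonneg _ _ (by norm_num), Real.sqrt_eq_rpow,
      ← ENNReal.ofReal_rpow_of_pos two_pos, ENNReal.ofReal_ofNat]
end

section
/- Assume f(0) = 1, sup_{t ∈ [0,∞)} |f(t)| < ∞ and sup_{t ∈ (0,∞)} |t · f′(t²)| < ∞. Then there exists a constant κ ∈ (0,∞), depending only on f, such that for every real γ ≥ 0, every integer n ≥ 1 and all x, y ∈ H: ‖(DΠ^n)(x)(y) − y‖ ≤ κ · ‖x‖ · ‖y‖; in other words, the operator norm of (DΠ^n)(x) − Id on H is at most κ‖x‖. -/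
/-- The taming map `Π^n(x) = f(½‖x‖² n^{-2γ}) • x`. -/
noncomputable def tamingMap {H : Type*} [NormedAddCommGroup H] [InnerProductSpace ℝ H]
    (f : ℝ → ℝ) (γ : ℝ) (n : ℕ) (x : H) : H :=
  f (2⁻¹ * ‖x‖ ^ 2 * (n : ℝ) ^ (-(2 * γ))) • x

theorem abs_comp_sq_sub_le_of_abs_mul_deriv_sq_le {f : ℝ → ℝ} (hf : Differentiable ℝ f) {M : ℝ}
    (hM : ∀ t : ℝ, 0 ≤ t → |t * deriv f (t ^ 2)| ≤ M) {t : ℝ} (ht : 0 ≤ t) :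
    |f (t ^ 2) - f 0| ≤ 2 * M * t := by
  have hderiv : ∀ s ∈ Set.Ici (0 : ℝ), HasDerivWithinAt (fun s => f (s ^ 2))
      (2 * (s * deriv f (s ^ 2))) (Set.Ici 0) s := fun s _ => by
    have h := (hf (s ^ 2)).hasDerivAt.comp s (hasDerivAt_pow 2 s)
    refine (h.congr_deriv ?_).hasDerivWithinAt
    push_cast
    ring
  have hbound : ∀ s ∈ Set.Ici (0 : ℝ), ‖2 * (s * deriv f (s ^ 2))‖ ≤ 2 * M := fun s hs => by
    rw [Real.norm_eq_abs, abs_mul, abs_two]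
    exact mul_le_mul_of_nonneg_left (hM s hs) zero_le_two
  simpa [Real.norm_eq_abs, abs_of_nonneg ht] using
    (convex_Ici (0 : ℝ)).norm_image_sub_le_of_norm_hasDerivWithin_le hderiv hbound
      Set.self_mem_Ici ht

theorem fderiv_tamingMap_apply {H : Type*} [NormedAddCommGroup H] [InnerProductSpace ℝ H]
    {f : ℝ → ℝ} (hf : Differentiable ℝ f) (γ : ℝ) (n : ℕ) (x y : H) :
    fderiv ℝ (tamingMap (H := H) f γ n) x y =
      f (2⁻¹ * ‖x‖ ^ 2 * (n : ℝ) ^ (-(2 * γ))) • y +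
        (deriv f (2⁻¹ * ‖x‖ ^ 2 * (n : ℝ) ^ (-(2 * γ))) *
          ((n : ℝ) ^ (-(2 * γ)) * inner ℝ x y)) • x := by
  have h1 := ((hasStrictFDerivAt_norm_sq x).hasFDerivAt.const_mul (2⁻¹ : ℝ)).mul_const
    ((n : ℝ) ^ (-(2 * γ)))
  have h2 := (hf (2⁻¹ * ‖x‖ ^ 2 * (n : ℝ) ^ (-(2 * γ)))).hasDerivAt.comp_hasFDerivAt x h1
  have h3 : HasFDerivAt (tamingMap (H := H) f γ n) _ x := h2.smul (hasFDerivAt_id x)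
  rw [h3.fderiv]
  simp

/-- If `f(0) = 1`, `sup_{t ≥ 0} |f(t)| < ∞` and `sup_{t > 0} |t f'(t²)| < ∞`, then there is a
constant `κ ∈ (0,∞)` such that for all `γ ≥ 0`, `n ≥ 1` and `x, y ∈ H`:
`‖(DΠ^n)(x)(y) - y‖ ≤ κ ‖x‖ ‖y‖`. -/
theorem tamingMap_fderiv_sub_id_bound
    {H : Type*} [NormedAddCommGroup H] [InnerProductSpace ℝ H] [CompleteSpace H]
    (f : ℝ → ℝ) (hf : ContDiff ℝ 2 f) (hf0 : f 0 = 1)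
    (hM0 : BddAbove ((fun t => |f t|) '' Set.Ici (0 : ℝ)))
    (hM1 : BddAbove ((fun t => |t * deriv f (t ^ 2)|) '' Set.Ioi (0 : ℝ))) :
    ∃ κ : ℝ, 0 < κ ∧ ∀ γ : ℝ, 0 ≤ γ → ∀ n : ℕ, 1 ≤ n → ∀ x y : H,
      ‖fderiv ℝ (tamingMap (H := H) f γ n) x y - y‖ ≤ κ * ‖x‖ * ‖y‖ := by
  obtain ⟨M, hM⟩ := hM1
  have hMpos : ∀ t : ℝ, 0 < t → |t * deriv f (t ^ 2)| ≤ M := fun t ht =>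
    hM (Set.mem_image_of_mem _ ht)
  have hM_nonneg : 0 ≤ M := (abs_nonneg _).trans (hMpos 1 one_pos)
  have hMnn : ∀ t : ℝ, 0 ≤ t → |t * deriv f (t ^ 2)| ≤ M := fun t ht => by
    rcases ht.eq_or_lt with rfl | ht
    · simpa using hM_nonneg
    · exact hMpos t ht
  have hfd : Differentiable ℝ f := hf.differentiable two_ne_zero
  refine ⟨4 * M + 1, by positivity, fun γ hγ n hn x y => ?_⟩
  rw [fderiv_tamingMap_apply hfd]
  have hc0 : 0 ≤ (n : ℝ) ^ (-(2 * γ)) := by positivity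
  have hc1 : (n : ℝ) ^ (-(2 * γ)) ≤ 1 :=
    Real.rpow_le_one_of_one_le_of_nonpos (by exact_mod_cast hn) (by linarith)
  generalize (n : ℝ) ^ (-(2 * γ)) = c at hc0 hc1 ⊢
  obtain ⟨t, ht0, ht⟩ : ∃ t : ℝ, 0 ≤ t ∧ t ^ 2 = 2⁻¹ * ‖x‖ ^ 2 * c :=
    ⟨√(2⁻¹ * ‖x‖ ^ 2 * c), Real.sqrt_nonneg _, Real.sq_sqrt (by positivity)⟩
  have htx : t ≤ ‖x‖ := by
    refine (pow_le_pow_iff_left₀ ht0 (norm_nonneg x) two_ne_zero).1 ?_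
    nlinarith [mul_le_mul_of_nonneg_left hc1 (sq_nonneg ‖x‖), sq_nonneg ‖x‖]
  rw [← ht]
  have hzero : |f (t ^ 2) - 1| ≤ 2 * M * ‖x‖ := by
    rw [← hf0]
    exact (abs_comp_sq_sub_le_of_abs_mul_deriv_sq_le hfd hMnn ht0).trans (by gcongr)
  have hfirst : ‖(deriv f (t ^ 2) * (c * inner ℝ x y)) • x‖ ≤ 2 * M * ‖x‖ * ‖y‖ := by
    calc ‖(deriv f (t ^ 2) * (c * inner ℝ x y)) • x‖
        = |deriv f (t ^ 2)| * (c * |inner ℝ x y|) * ‖x‖ := by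
          rw [norm_smul, Real.norm_eq_abs, abs_mul, abs_mul, abs_of_nonneg hc0]
      _ ≤ |deriv f (t ^ 2)| * (c * (‖x‖ * ‖y‖)) * ‖x‖ := by
          gcongr
          exact abs_real_inner_le_norm x y
      _ = 2 * |t * deriv f (t ^ 2)| * t * ‖y‖ := by
          rw [abs_mul, abs_of_nonneg ht0]
          linear_combination (-2 * |deriv f (t ^ 2)| * ‖y‖) * ht
      _ ≤ 2 * M * ‖x‖ * ‖y‖ := by
          gcongr
          exact hMnn t ht0
  calc ‖f (t ^ 2) • y + (deriv f (t ^ 2) * (c * inner ℝ x y)) • x - y‖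
      = ‖(f (t ^ 2) - 1) • y + (deriv f (t ^ 2) * (c * inner ℝ x y)) • x‖ := by
        congr 1
        module
    _ ≤ ‖(f (t ^ 2) - 1) • y‖ + ‖(deriv f (t ^ 2) * (c * inner ℝ x y)) • x‖ := norm_add_le _ _
    _ ≤ 2 * M * ‖x‖ * ‖y‖ + 2 * M * ‖x‖ * ‖y‖ := by
        refine add_le_add ?_ hfirst
        rw [norm_smul, Real.norm_eq_abs]
        gcongr
    _ ≤ (4 * M + 1) * ‖x‖ * ‖y‖ := by
        nlinarith [mul_nonneg (norm_nonneg x) (norm_nonneg y)]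
end

section
/- Assume M₁ := sup_{t ∈ (0,∞)} |t · f′(t²)| < ∞. Then for every integer n ≥ 1 and all x, y ∈ H: ‖(DΠ^n)(x)(y) − f(½‖x‖² n^{−2γ}) · y‖ ≤ 2 M₁ · ‖x‖ · ‖y‖. -/
theorem hasFDerivAt_tamingMap {H : Type*} [NormedAddCommGroup H] [InnerProductSpace ℝ H]
    {f : ℝ → ℝ} (hf : Differentiable ℝ f) (γ : ℝ) (n : ℕ) (x : H) :
    HasFDerivAt (tamingMap (H := H) f γ n)
      (f (2⁻¹ * ‖x‖ ^ 2 * (n : ℝ) ^ (-(2 * γ))) • ContinuousLinearMap.id ℝ H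
        + ((deriv f (2⁻¹ * ‖x‖ ^ 2 * (n : ℝ) ^ (-(2 * γ))) * (n : ℝ) ^ (-(2 * γ))) •
            innerSL ℝ x).smulRight x) x := by
  have hnorm := (hasStrictFDerivAt_norm_sq x).hasFDerivAt
  have hscalar := ((hnorm.const_mul (2⁻¹ : ℝ)).mul_const ((n : ℝ) ^ (-(2 * γ))))
  have hcomp := (hf (2⁻¹ * ‖x‖ ^ 2 * (n : ℝ) ^ (-(2 * γ)))).hasDerivAt.comp_hasFDerivAt x hscalar
  refine (hcomp.smul (hasFDerivAt_id x)).congr_fderiv ?_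
  ext y
  simp
  ring_nf

/-- With `M₁ = sup_{t > 0} |t f'(t²)|`:
`‖(DΠ^n)(x)(y) - f(½‖x‖² n^{-2γ}) y‖ ≤ 2 M₁ ‖x‖ ‖y‖`. -/
theorem tamingMap_fderiv_sub_scalar_bound
    {H : Type*} [NormedAddCommGroup H] [InnerProductSpace ℝ H] [CompleteSpace H]
    (f : ℝ → ℝ) (hf : ContDiff ℝ 2 f) (γ : ℝ) (hγ : 0 ≤ γ)
    (hM1 : BddAbove ((fun t => |t * deriv f (t ^ 2)|) '' Set.Ioi (0 : ℝ)))
    (n : ℕ) (hn : 1 ≤ n) (x y : H) :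
    ‖fderiv ℝ (tamingMap (H := H) f γ n) x y
        - f (2⁻¹ * ‖x‖ ^ 2 * (n : ℝ) ^ (-(2 * γ))) • y‖
      ≤ 2 * sSup ((fun t => |t * deriv f (t ^ 2)|) '' Set.Ioi (0 : ℝ)) * ‖x‖ * ‖y‖ := by
  rw [(hasFDerivAt_tamingMap (hf.differentiable (by norm_num)) γ n x).fderiv]
  set M := sSup ((fun t => |t * deriv f (t ^ 2)|) '' Set.Ioi (0 : ℝ))
  set c : ℝ := (n : ℝ) ^ (-(2 * γ))
  have hn1 : (1 : ℝ) ≤ n := by exact_mod_cast hn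
  have hc0 : 0 < c := Real.rpow_pos_of_pos (by linarith) _
  have hc1 : c ≤ 1 := Real.rpow_le_one_of_one_le_of_nonpos hn1 (by linarith)
  obtain rfl | hx := eq_or_ne x 0
  · simp
  have hx' : 0 < ‖x‖ := norm_pos_iff.mpr hx
  obtain ⟨d, hd0, hd⟩ : ∃ d : ℝ, 0 < d ∧ 2 * d ^ 2 = c :=
    ⟨√(c / 2), by positivity, by rw [Real.sq_sqrt (by positivity)]; ring⟩
  have hd1 : d ≤ 1 := by nlinarith
  have hM : |d * ‖x‖ * deriv f ((d * ‖x‖) ^ 2)| ≤ M :=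
    le_csSup hM1 ⟨d * ‖x‖, mul_pos hd0 hx', rfl⟩
  have hM0 : 0 ≤ M := (abs_nonneg _).trans hM
  have harg : 2⁻¹ * ‖x‖ ^ 2 * c = (d * ‖x‖) ^ 2 := by rw [← hd]; ring
  rw [harg]
  rw [abs_mul, abs_of_pos (mul_pos hd0 hx')] at hM
  set a := deriv f ((d * ‖x‖) ^ 2)
  calc _ = |a| * c * |inner ℝ x y| * ‖x‖ := by
        simp [norm_smul, abs_of_pos hc0]
    _ ≤ |a| * c * (‖x‖ * ‖y‖) * ‖x‖ := by
        gcongr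
        exact abs_real_inner_le_norm x y
    _ = 2 * d * (d * ‖x‖ * |a|) * ‖x‖ * ‖y‖ := by rw [← hd]; ring
    _ ≤ 2 * 1 * M * ‖x‖ * ‖y‖ := by gcongr
    _ = 2 * M * ‖x‖ * ‖y‖ := by ring
end

section
/- Let H be a real inner product space, η ∈ ℝ, T > 0, and define V : ℝ × H → ℝ by V(t,x) = e^{−t η²} · (‖x‖² + 1). Then for all real numbers t, s with 0 ≤ t ≤ s ≤ T and all x, y ∈ H: |V(t,x) − V(s,y)| ≤ (s − t + ‖x − y‖) · (η² + e^{T η²}) · (V(t,x) + ‖x − y‖ + 1). -/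
/-- Local Lipschitz-type estimate for the Lyapunov function `V(t,x) = e^{-tη²}(‖x‖²+1)`:
for `0 ≤ t ≤ s ≤ T` and `x, y ∈ H`,
`|V(t,x) - V(s,y)| ≤ (s-t+‖x-y‖)(η²+e^{Tη²})(V(t,x)+‖x-y‖+1)`. -/
theorem lyapunov_local_lipschitz
    {H : Type*} [NormedAddCommGroup H] [InnerProductSpace ℝ H]
    (η T : ℝ) (hT : 0 < T)
    (V : ℝ → H → ℝ) (hV : ∀ t x, V t x = Real.exp (-t * η ^ 2) * (‖x‖ ^ 2 + 1))
    (t s : ℝ) (ht : 0 ≤ t) (hts : t ≤ s) (hsT : s ≤ T) (x y : H) :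
    |V t x - V s y|
      ≤ (s - t + ‖x - y‖) * (η ^ 2 + Real.exp (T * η ^ 2)) * (V t x + ‖x - y‖ + 1) := by
  rw [hV t x, hV s y]
  set a := Real.exp (-t * η ^ 2) with ha
  set b := Real.exp (-s * η ^ 2) with hb
  set d := ‖x - y‖ with hd
  have ha0 : 0 < a := Real.exp_pos _
  have hb0 : 0 < b := Real.exp_pos _
  have hη : 0 ≤ η ^ 2 := sq_nonneg η
  have hd0 : 0 ≤ d := norm_nonneg _
  have hX0 : 0 ≤ ‖x‖ := norm_nonneg _
  have hY0 : 0 ≤ ‖y‖ := norm_nonneg _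
  have hst : 0 ≤ s - t := sub_nonneg.2 hts
  have hba : b ≤ a := Real.exp_le_exp.2 (by nlinarith)
  have hb1 : b ≤ 1 := Real.exp_le_one_iff.2 (by nlinarith)
  have hE : 1 ≤ Real.exp (T * η ^ 2) := Real.one_le_exp (by positivity)
  have hab : a - b ≤ (s - t) * η ^ 2 * a := by
    have h : b = a * Real.exp (-((s - t) * η ^ 2)) := by
      rw [ha, hb, ← Real.exp_add]
      ring_nf
    have h' := mul_le_mul_of_nonneg_left (Real.add_one_le_exp (-((s - t) * η ^ 2))) ha0.le
    linarith
  have hXY : |‖x‖ - ‖y‖| ≤ d := abs_norm_sub_norm_le x y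
  have hsum : ‖x‖ + ‖y‖ ≤ 2 * ‖x‖ + d := by linarith [neg_le_of_abs_le hXY]
  have hsq : |‖x‖ ^ 2 - ‖y‖ ^ 2| ≤ d * (2 * ‖x‖ + d) := by
    rw [sq_sub_sq, abs_mul, abs_of_nonneg (add_nonneg hX0 hY0), mul_comm]
    exact mul_le_mul hXY hsum (add_nonneg hX0 hY0) hd0
  have hspace : b * (2 * ‖x‖ + d) ≤ a * (‖x‖ ^ 2 + 1) + d := by
    have h₁ : b * (2 * ‖x‖) ≤ a * (‖x‖ ^ 2 + 1) :=
      mul_le_mul hba (by nlinarith [sq_nonneg (‖x‖ - 1)]) (by positivity) ha0.le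
    have h₂ : b * d ≤ d := mul_le_of_le_one_left hd0 hb1
    linarith
  set v := a * (‖x‖ ^ 2 + 1) with hv
  have hv0 : 0 ≤ v := by positivity
  calc |v - b * (‖y‖ ^ 2 + 1)|
      = |(a - b) * (‖x‖ ^ 2 + 1) + b * (‖x‖ ^ 2 - ‖y‖ ^ 2)| := by
        rw [hv]
        ring_nf
    _ ≤ (a - b) * (‖x‖ ^ 2 + 1) + b * |‖x‖ ^ 2 - ‖y‖ ^ 2| := by
        refine (abs_add_le _ _).trans_eq ?_
        rw [abs_of_nonneg (mul_nonneg (sub_nonneg.2 hba) (by positivity)), abs_mul,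
          abs_of_pos hb0]
    _ ≤ (s - t) * η ^ 2 * a * (‖x‖ ^ 2 + 1) + b * (d * (2 * ‖x‖ + d)) := by gcongr
    _ = (s - t) * η ^ 2 * v + d * (b * (2 * ‖x‖ + d)) := by
        rw [hv]
        ring
    _ ≤ (s - t) * (η ^ 2 + Real.exp (T * η ^ 2)) * (v + d + 1)
          + d * ((η ^ 2 + Real.exp (T * η ^ 2)) * (v + d + 1)) := by
        have h₁ : (s - t) * η ^ 2 * v
            ≤ (s - t) * (η ^ 2 + Real.exp (T * η ^ 2)) * (v + d + 1) := by
          gcongr <;> linarith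
        have h₂ : b * (2 * ‖x‖ + d) ≤ (η ^ 2 + Real.exp (T * η ^ 2)) * (v + d + 1) :=
          calc b * (2 * ‖x‖ + d) ≤ 1 * (v + d + 1) := by linarith
            _ ≤ _ := by gcongr; linarith
        gcongr
    _ = _ := by ring
end
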